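/- In the algebra D2 of the context, the cubic relations of the regular cubic algebra C1 hold: x2^2·x1 = (a^2 − c·a^{-2})·x2x1x2 + c·x1x2^2 and x2·x1^2 = (a^2 − c·a^{-2})·x1x2x1 + c·x1^2x2; that is, the corresponding cubic elements of the free algebra lie in the two-sided ideal generated by r1,…,r6. -/

import Mathlib

noncomputable section

open FreeAlgebra

/-- The relation used to quotient a free algebra by the two-sided
ideal generated by the set `s`. -/
def genRel {k : Type} [Field k] {n : ℕ} (s : Set (FreeAlgebra k (Fin n))) :
    FreeAlgebra k (Fin n) → FreeAlgebra k (Fin n) → Prop :=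
  fun a b => a ∈ s ∧ b = 0

/-- The degree-`m` homogeneous component of the free algebra:
the span of the words of length `m` in the generators. -/
def degF (k : Type) [Field k] (n m : ℕ) : Submodule k (FreeAlgebra k (Fin n)) :=
  (Submodule.span k (Set.range (FreeAlgebra.ι k)) : Submodule k (FreeAlgebra k (Fin n))) ^ m

/-- The degree-`m` component of the quotient algebra: the image of the span of
the words of length `m`. -/
def degQ (k : Type) [Field k] {n : ℕ} (s : Set (FreeAlgebra k (Fin n))) (m : ℕ) :
    Submodule k (RingQuot (genRel s)) :=
  (degF k n m).map (RingQuot.mkAlgHom k (genRel s)).toLinearMap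

/-- If `z` skew-commutes with `x` up to the scalar `q`, then `z ^ 2` does so up to `q ^ 2`. -/
lemma sq_mul_eq_smul_mul_sq {R A : Type*} [CommSemiring R] [Semiring A] [Algebra R A] {q : R}
    {x z : A} (h : z * x = q • (x * z)) : z ^ 2 * x = q ^ 2 • (x * z ^ 2) := by
  rw [pow_two z, mul_assoc, h, mul_smul_comm, ← mul_assoc, h, smul_mul_assoc, smul_smul,
    ← pow_two q, mul_assoc]

/-- The first cubic relation: `x` and `y` satisfy it as soon as `y * x + (c / a ^ 2) • (x * y)` is
the square of an element skew-commuting with `y`. -/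
lemma sq_mul_eq_of_skew_comm {k A : Type*} [Field k] [Ring A] [Algebra k A] {a c : k} (ha : a ≠ 0)
    {x y z : A} (hz : z ^ 2 = y * x + (c * (a ^ 2)⁻¹) • (x * y)) (hy : z * y = a⁻¹ • (y * z)) :
    y ^ 2 * x = (a ^ 2 - c * (a ^ 2)⁻¹) • (y * x * y) + c • (x * y ^ 2) := by
  have h := congrArg (fun t => a ^ 2 • t) (sq_mul_eq_smul_mul_sq hy)
  simp only [hz, add_mul, mul_add, smul_mul_assoc, mul_smul_comm, smul_add, smul_smul] at h
  have h1 : a ^ 2 * a⁻¹ ^ 2 = 1 := by field_simp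
  have h2 : a ^ 2 * (c * (a ^ 2)⁻¹) = c := by field_simp
  simp only [← mul_assoc] at h h2
  rw [h1, h2, one_smul, one_mul] at h
  rw [sub_smul, sub_add_eq_add_sub, eq_sub_iff_add_eq, pow_two y, ← mul_assoc]
  exact h.symm

/-- The second cubic relation: `x` and `y` satisfy it as soon as `y * x + (c / a ^ 2) • (x * y)` is
the square of an element skew-commuting with `x`. -/
lemma mul_sq_eq_of_skew_comm {k A : Type*} [Field k] [Ring A] [Algebra k A] {a c : k} (ha : a ≠ 0)
    {x y z : A} (hz : z ^ 2 = y * x + (c * (a ^ 2)⁻¹) • (x * y)) (hx : z * x = a • (x * z)) :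
    y * x ^ 2 = (a ^ 2 - c * (a ^ 2)⁻¹) • (x * y * x) + c • (x ^ 2 * y) := by
  have h := sq_mul_eq_smul_mul_sq hx
  simp only [hz, add_mul, mul_add, smul_mul_assoc, mul_smul_comm, smul_add, smul_smul] at h
  have h2 : a ^ 2 * (c * (a ^ 2)⁻¹) = c := by field_simp
  rw [h2] at h
  rw [sub_smul, sub_add_eq_add_sub, eq_sub_iff_add_eq, pow_two x, ← mul_assoc]
  simpa only [← mul_assoc] using h

/-- The quotient map by the ideal generated by `s` kills `s`. -/
lemma mkAlgHom_genRel_eq_zero {k : Type} [Field k] {n : ℕ} {s : Set (FreeAlgebra k (Fin n))}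
    {r : FreeAlgebra k (Fin n)} (hr : r ∈ s) : RingQuot.mkAlgHom k (genRel s) r = 0 := by
  simpa using RingQuot.mkAlgHom_rel k (show genRel s r 0 from ⟨hr, rfl⟩)

/-- in the algebra `D2` (with `a ≠ 0`, `c ≠ 0`), the cubic
relations of the regular cubic algebra `C1` hold:
`x2²x1 = (a² − c·a⁻²)·x2x1x2 + c·x1x2²` and
`x2x1² = (a² − c·a⁻²)·x1x2x1 + c·x1²x2`; i.e. the corresponding cubic
elements of the free algebra lie in the two-sided ideal generated by
`r1,…,r6`. -/
theorem stmt16 (k : Type) [Field k] [IsAlgClosed k] [CharZero k]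
    (a c : k) (ha : a ≠ 0) (hc : c ≠ 0) :
    ∀ (x1 x2 x3 x4 : FreeAlgebra k (Fin 4)),
      x1 = FreeAlgebra.ι k 0 → x2 = FreeAlgebra.ι k 1 →
      x3 = FreeAlgebra.ι k 2 → x4 = FreeAlgebra.ι k 3 →
      ∀ (r1 r2 r3 r4 r5 r6 : FreeAlgebra k (Fin 4)),
        r1 = x3 ^ 2 - x2 * x1 - (c * (a ^ 2)⁻¹) • (x1 * x2) →
        r2 = x3 * x1 - a • (x1 * x3) →
        r3 = x3 * x2 - a⁻¹ • (x2 * x3) →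
        r4 = x4 ^ 2 - x2 * x1 - (c * (a ^ 2)⁻¹) • (x1 * x2) →
        r5 = x4 * x1 - a • (x1 * x4) →
        r6 = x4 * x2 - a⁻¹ • (x2 * x4) →
        ∀ (π : FreeAlgebra k (Fin 4) →ₐ[k]
            RingQuot (genRel {r1, r2, r3, r4, r5, r6})),
          π = RingQuot.mkAlgHom k (genRel {r1, r2, r3, r4, r5, r6}) →
          π (x2 ^ 2 * x1) =
            π ((a ^ 2 - c * (a ^ 2)⁻¹) • (x2 * x1 * x2) + c • (x1 * x2 ^ 2)) ∧
          π (x2 * x1 ^ 2) =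
            π ((a ^ 2 - c * (a ^ 2)⁻¹) • (x1 * x2 * x1) + c • (x1 ^ 2 * x2)) := by
  intro x1 x2 x3 x4 _ _ _ _ r1 r2 r3 r4 r5 r6 h1 h2 h3 _ _ _ π hπ
  have hπr : ∀ r ∈ ({r1, r2, r3, r4, r5, r6} : Set (FreeAlgebra k (Fin 4))), π r = 0 :=
    fun r hr => hπ ▸ mkAlgHom_genRel_eq_zero hr
  have e1 := hπr r1 (by simp)
  have e2 := hπr r2 (by simp)
  have e3 := hπr r3 (by simp)
  simp only [h1, h2, h3, map_sub, map_add, map_smul, map_mul, map_pow, sub_sub, sub_eq_zero] at e1 e2 e3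
  simp only [map_add, map_smul, map_mul, map_pow]
  exact ⟨sq_mul_eq_of_skew_comm ha e1 e3, mul_sq_eq_of_skew_comm ha e1 e2⟩
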